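/- arXiv:2410.23152 — 3 statements merged into one kernel-verified Lean document; each statement's English description precedes it below -/
import Mathlib

section
/- Let α,β,γ,δ ∈ ℂ satisfy |α|²+|β|²+|γ|²+|δ|² = 1, and let ρ be the 2×2 Hermitian matrix with entries ρ_{00} = |α|²+|γ|², ρ_{11} = |β|²+|δ|², ρ_{01} = α·conj(δ) + conj(β)·γ, ρ_{10} = conj(ρ_{01}) (the reduced density matrix on the first qubit of the state α|00⟩+β|11⟩+γ|01⟩+δ|10⟩). Set q0 := |α|²+|β|² and q1 := |γ|²+|δ|². Then S(ρ) ≤ q0 · h(|α|²/q0) + q1 · h(|γ|²/q1), where a summand on the right-hand side is read as 0 when the corresponding q0 or q1 vanishes. -/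
open Classical

/-- Von Neumann entropy (natural log) of a matrix, via the eigenvalues of a
Hermitian matrix; junk value 0 for non-Hermitian matrices. -/
noncomputable def vnEntropy {n : Type*} [Fintype n] [DecidableEq n] (ρ : Matrix n n ℂ) : ℝ :=
  if h : ρ.IsHermitian then ∑ i, Real.negMulLog (h.eigenvalues i) else 0

/-- Binary entropy h(t) = −t ln t − (1−t) ln(1−t). -/
noncomputable def binEnt (t : ℝ) : ℝ := Real.negMulLog t + Real.negMulLog (1 - t)

/-- The entropy of the reduced state of a pure two-qubit state, as a function of its concurrence. -/
noncomputable def concurrenceEntropy (c : ℝ) : ℝ :=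
  Real.binEntropy ((1 + √(1 - c ^ 2)) / 2)

lemma binEnt_eq_binEntropy (t : ℝ) : binEnt t = Real.binEntropy t := by
  rw [binEnt, Real.binEntropy_eq_negMulLog_add_negMulLog_one_sub]

lemma concurrenceEntropy_eq_binEnt {c p : ℝ} (h : c ^ 2 = 4 * (p * (1 - p))) :
    concurrenceEntropy c = binEnt p := by
  have hsq : 1 - c ^ 2 = (1 - 2 * p) ^ 2 := by rw [h]; ring
  rw [concurrenceEntropy, binEnt_eq_binEntropy, hsq, Real.sqrt_sq_eq_abs]
  rcases abs_cases (1 - 2 * p) with ⟨ha, -⟩ | ⟨ha, -⟩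
  · rw [ha, ← Real.binEntropy_one_sub]
    congr 1
    ring
  · rw [ha]
    congr 1
    ring

lemma monotoneOn_concurrenceEntropy : MonotoneOn concurrenceEntropy (Set.Icc 0 1) := by
  intro a ha b hb hab
  have h1 : √(1 - b ^ 2) ≤ √(1 - a ^ 2) := Real.sqrt_le_sqrt (by nlinarith [ha.1])
  have h2 : √(1 - a ^ 2) ≤ 1 := Real.sqrt_le_one.2 (by nlinarith)
  have h3 := Real.sqrt_nonneg (1 - b ^ 2)
  refine Real.binEntropy_strictAntiOn.antitoneOn ⟨?_, ?_⟩ ⟨?_, ?_⟩ ?_ <;> linarith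

lemma two_mul_le_log_one_add_sub_log_one_sub {x : ℝ} (h0 : 0 ≤ x) (h1 : x < 1) :
    2 * x ≤ Real.log (1 + x) - Real.log (1 - x) := by
  have hs := Real.hasSum_log_sub_log_of_abs_lt_one (x := x) (by rwa [abs_of_nonneg h0])
  have := le_hasSum hs 0 fun j _ => by positivity
  simpa using this

lemma hasDerivAt_sqrt_one_sub_sq {c : ℝ} (hc : c ∈ Set.Ioo (0 : ℝ) 1) :
    HasDerivAt (fun t : ℝ => √(1 - t ^ 2)) (-c / √(1 - c ^ 2)) c := by
  have hpos : 0 < 1 - c ^ 2 := by nlinarith [hc.1, hc.2]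
  convert ((hasDerivAt_pow 2 c).const_sub 1).sqrt hpos.ne' using 1
  field_simp
  simp [mul_comm]

lemma sqrt_one_sub_sq_mem_Ioo {c : ℝ} (hc : c ∈ Set.Ioo (0 : ℝ) 1) :
    √(1 - c ^ 2) ∈ Set.Ioo (0 : ℝ) 1 := by
  refine ⟨Real.sqrt_pos.2 (by nlinarith [hc.1, hc.2]), ?_⟩
  rw [Real.sqrt_lt' one_pos]
  nlinarith [hc.1]

lemma hasDerivAt_concurrenceEntropy {c : ℝ} (hc : c ∈ Set.Ioo (0 : ℝ) 1) :
    HasDerivAt concurrenceEntropy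
      (c * (Real.log (1 + √(1 - c ^ 2)) - Real.log (1 - √(1 - c ^ 2))) / (2 * √(1 - c ^ 2))) c := by
  obtain ⟨hx0, hx1⟩ := sqrt_one_sub_sq_mem_Ioo hc
  have hs := ((hasDerivAt_sqrt_one_sub_sq hc).const_add 1).div_const 2
  have hb := Real.hasDerivAt_binEntropy (p := (1 + √(1 - c ^ 2)) / 2) (by linarith) (by linarith)
  refine (hb.comp c hs).congr_deriv ?_
  have e : 1 - (1 + √(1 - c ^ 2)) / 2 = (1 - √(1 - c ^ 2)) / 2 := by ring
  rw [e, Real.log_div (by linarith) two_ne_zero, Real.log_div (by linarith) two_ne_zero]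
  field_simp
  ring

lemma hasDerivAt_deriv_concurrenceEntropy {c : ℝ} (hc : c ∈ Set.Ioo (0 : ℝ) 1) :
    HasDerivAt
      (fun t : ℝ =>
        t * (Real.log (1 + √(1 - t ^ 2)) - Real.log (1 - √(1 - t ^ 2))) / (2 * √(1 - t ^ 2)))
      ((Real.log (1 + √(1 - c ^ 2)) - Real.log (1 - √(1 - c ^ 2)) - 2 * √(1 - c ^ 2)) /
        (2 * √(1 - c ^ 2) ^ 3)) c := by
  obtain ⟨hx0, hx1⟩ := sqrt_one_sub_sq_mem_Ioo hc
  have hs := hasDerivAt_sqrt_one_sub_sq hc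
  have hsq : √(1 - c ^ 2) ^ 2 = 1 - c ^ 2 := Real.sq_sqrt (by nlinarith [hc.1, hc.2])
  have h := ((hasDerivAt_id c).mul
    (((hs.const_add 1).log (by linarith)).sub ((hs.const_sub 1).log (by linarith)))).div
    (hs.const_mul 2) (by positivity)
  refine h.congr_deriv ?_
  simp only [id, Pi.mul_apply, Pi.sub_apply]
  generalize √(1 - c ^ 2) = x at *
  have hm : 1 - x ≠ 0 := by linarith
  have hp : 1 + x ≠ 0 := by linarith
  have hc2 : c ^ 2 = 1 - x ^ 2 := by linarith
  generalize Real.log (1 + x) = u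
  generalize Real.log (1 - x) = v
  have e : -c / x / (1 + x) - -(-c / x) / (1 - x) = -2 / (c * x) := by
    have := hc.1
    field_simp
    linear_combination -2 * hc2
  rw [e]
  have := hc.1
  field_simp
  linear_combination (u - v) * hc2

lemma convexOn_concurrenceEntropy : ConvexOn ℝ (Set.Icc 0 1) concurrenceEntropy := by
  refine convexOn_of_hasDerivWithinAt2_nonneg (convex_Icc 0 1) ?_
    (fun c hc => (hasDerivAt_concurrenceEntropy (by simpa using hc)).hasDerivWithinAt)
    (fun c hc => (hasDerivAt_deriv_concurrenceEntropy (by simpa using hc)).hasDerivWithinAt) ?_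
  · unfold concurrenceEntropy
    fun_prop
  · intro c hc
    obtain ⟨hx0, hx1⟩ := sqrt_one_sub_sq_mem_Ioo (c := c) (by simpa using hc)
    have := two_mul_le_log_one_add_sub_log_one_sub hx0.le hx1
    exact div_nonneg (by linarith) (by positivity)

/-- A trace-one Hermitian `2 × 2` matrix with determinant `c² / 4` has entropy given by `c`. -/
lemma vnEntropy_eq_concurrenceEntropy {ρ : Matrix (Fin 2) (Fin 2) ℂ} (hρ : ρ.IsHermitian)
    (htr : ρ.trace = 1) {c : ℝ} (hdet : ρ.det = (((c / 2) ^ 2 : ℝ) : ℂ)) :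
    vnEntropy ρ = concurrenceEntropy c := by
  rw [hρ.trace_eq_sum_eigenvalues, Fin.sum_univ_two] at htr
  rw [hρ.det_eq_prod_eigenvalues, Fin.prod_univ_two] at hdet
  have htr' : hρ.eigenvalues 0 + hρ.eigenvalues 1 = 1 :=
    Complex.ofReal_injective (by simpa using htr)
  have hdet' : hρ.eigenvalues 0 * hρ.eigenvalues 1 = (c / 2) ^ 2 :=
    Complex.ofReal_injective (by simpa using hdet)
  have e : hρ.eigenvalues 1 = 1 - hρ.eigenvalues 0 := by linarith
  rw [e] at hdet'
  rw [concurrenceEntropy_eq_binEnt (by rw [hdet']; ring), vnEntropy, dif_pos hρ, Fin.sum_univ_two, e, binEnt]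

/-- The concurrence of the normalized state `(a, b)`, together with its entropy; for `a = b = 0`
all divisions by zero are harmless. -/
lemma concurrence_of_pair {a b : ℝ} (ha : 0 ≤ a) (hb : 0 ≤ b) :
    2 * a * b / (a ^ 2 + b ^ 2) ∈ Set.Icc (0 : ℝ) 1 ∧
      (a ^ 2 + b ^ 2) * (2 * a * b / (a ^ 2 + b ^ 2)) = 2 * a * b ∧
      concurrenceEntropy (2 * a * b / (a ^ 2 + b ^ 2)) = binEnt (a ^ 2 / (a ^ 2 + b ^ 2)) := by
  by_cases hq : a ^ 2 + b ^ 2 = 0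
  · have ha0 : a = 0 := by nlinarith
    have hb0 : b = 0 := by nlinarith
    subst ha0 hb0
    refine ⟨by simp, by simp, concurrenceEntropy_eq_binEnt (by simp)⟩
  · refine ⟨⟨by positivity, ?_⟩, by field_simp, concurrenceEntropy_eq_binEnt ?_⟩
    · rw [div_le_one (by positivity)]
      exact two_mul_le_add_sq a b
    · field_simp
      ring

/-- Entropy bound for the reduced density matrix of α|00⟩+β|11⟩+γ|01⟩+δ|10⟩ on
the first qubit: S(ρ) ≤ q0·h(|α|²/q0) + q1·h(|γ|²/q1). -/
theorem entropy_le_parity_conditional_entropy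
    (α β γ δ : ℂ) (h : ‖α‖ ^ 2 + ‖β‖ ^ 2 + ‖γ‖ ^ 2 + ‖δ‖ ^ 2 = 1)
    (ρ : Matrix (Fin 2) (Fin 2) ℂ)
    (h00 : ρ 0 0 = ((‖α‖ ^ 2 + ‖γ‖ ^ 2 : ℝ) : ℂ))
    (h11 : ρ 1 1 = ((‖β‖ ^ 2 + ‖δ‖ ^ 2 : ℝ) : ℂ))
    (h01 : ρ 0 1 = α * (starRingEnd ℂ) δ + (starRingEnd ℂ) β * γ)
    (h10 : ρ 1 0 = (starRingEnd ℂ) (ρ 0 1)) :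
    vnEntropy ρ ≤
      (‖α‖ ^ 2 + ‖β‖ ^ 2) * binEnt (‖α‖ ^ 2 / (‖α‖ ^ 2 + ‖β‖ ^ 2)) +
      (‖γ‖ ^ 2 + ‖δ‖ ^ 2) * binEnt (‖γ‖ ^ 2 / (‖γ‖ ^ 2 + ‖δ‖ ^ 2)) := by
  have hρ : ρ.IsHermitian := by
    ext i j
    fin_cases i <;> fin_cases j <;> simp [h00, h11, h10]
  have htr : ρ.trace = 1 := by
    rw [Matrix.trace_fin_two, h00, h11, ← Complex.ofReal_add, ← Complex.ofReal_one, ← h]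
    congr 1
    ring
  have hdet : ρ.det = (((2 * ‖α * β - γ * δ‖ / 2) ^ 2 : ℝ) : ℂ) := by
    rw [Matrix.det_fin_two, h10, h00, h11, h01, mul_div_cancel_left₀ _ two_ne_zero]
    simp only [Complex.sq_norm]
    apply Complex.ext <;> simp [Complex.normSq_apply] <;> ring
  rw [vnEntropy_eq_concurrenceEntropy hρ htr hdet]
  obtain ⟨hm0, hc0, he0⟩ := concurrence_of_pair (norm_nonneg α) (norm_nonneg β)
  obtain ⟨hm1, hc1, he1⟩ := concurrence_of_pair (norm_nonneg γ) (norm_nonneg δ)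
  rw [← he0, ← he1]
  have hq0 : 0 ≤ ‖α‖ ^ 2 + ‖β‖ ^ 2 := by positivity
  have hq1 : 0 ≤ ‖γ‖ ^ 2 + ‖δ‖ ^ 2 := by positivity
  have hsum : ‖α‖ ^ 2 + ‖β‖ ^ 2 + (‖γ‖ ^ 2 + ‖δ‖ ^ 2) = 1 := by linarith
  have hmem := convex_Icc (0 : ℝ) 1 hm0 hm1 hq0 hq1 hsum
  have hconv := convexOn_concurrenceEntropy.2 hm0 hm1 hq0 hq1 hsum
  simp only [smul_eq_mul, hc0, hc1] at hmem hconv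
  have hle : 2 * ‖α * β - γ * δ‖ ≤ 2 * ‖α‖ * ‖β‖ + 2 * ‖γ‖ * ‖δ‖ := by
    have := norm_sub_le (α * β) (γ * δ)
    rw [norm_mul, norm_mul] at this
    linarith
  exact (monotoneOn_concurrenceEntropy ⟨by positivity, hle.trans hmem.2⟩ hmem hle).trans hconv
end

section
/- Consider 2n qubits arranged as registers L₁,R₁,L₂,R₂,…,L_n,R_n in the state ⊗_{k=1}^n (a0|00⟩ + a1|11⟩)_{L_k R_k}, where a0,a1 ∈ ℂ with |a0|²+|a1|² = 1. For each j ∈ {1,…,n−1} fix an arbitrary orthonormal basis {u^{(j)}_1,…,u^{(j)}_4} of ℂ²⊗ℂ² and measure the pair of registers (R_j, L_{j+1}) jointly in this basis. For each outcome tuple (i₁,…,i_{n−1}), let P(i₁,…,i_{n−1}) be the squared norm of the projection of the global state onto ⊗_{j=1}^{n−1} u^{(j)}_{i_j} (acting on the measured registers), and let ρ₁^{(i₁,…,i_{n−1})} be the post-measurement reduced density matrix on register L₁, obtained by projecting, normalizing, and tracing out all other registers. Then the expected entropy of the post-measurement state on L₁ satisfies ∑_{(i₁,…,i_{n−1}) :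 P>0} P(i₁,…,i_{n−1}) · S(ρ₁^{(i₁,…,i_{n−1})}) ≤ (2·|a0·a1|)^n. -/
open Classical

/-- Matrix entries of the path sum of alternating factors `diagonal a` and `B j`. -/
noncomputable def chainMatrix (a : Fin 2 → ℂ) (n : ℕ) (B : Fin n → Matrix (Fin 2) (Fin 2) ℂ) :
    Matrix (Fin 2) (Fin 2) ℂ :=
  Matrix.of fun l r => ∑ c : Fin (n + 1) → Fin 2 × Fin 2,
    if (c 0).1 = l ∧ (c (Fin.last n)).2 = r then
      (∏ k : Fin (n + 1), if (c k).2 = (c k).1 then a (c k).1 else 0) *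
        ∏ j : Fin n, B j (c j.castSucc).2 (c j.succ).1
    else 0

theorem chainMatrix_zero (a : Fin 2 → ℂ) (B : Fin 0 → Matrix (Fin 2) (Fin 2) ℂ) :
    chainMatrix a 0 B = Matrix.diagonal a := by
  ext l r
  rw [chainMatrix, Matrix.of_apply, ← (Equiv.funUnique (Fin 1) (Fin 2 × Fin 2)).symm.sum_comp]
  fin_cases l <;> fin_cases r <;> simp [Fintype.sum_prod_type]

theorem chainMatrix_succ (a : Fin 2 → ℂ) (n : ℕ)
    (B : Fin (n + 1) → Matrix (Fin 2) (Fin 2) ℂ) :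
    chainMatrix a (n + 1) B =
      Matrix.diagonal a * (B 0 * chainMatrix a n fun j => B j.succ) := by
  ext l r
  rw [Matrix.diagonal_mul, Matrix.mul_apply]
  simp only [chainMatrix, Matrix.of_apply]
  rw [← (Fin.consEquiv fun _ : Fin (n + 2) => Fin 2 × Fin 2).sum_comp, Fintype.sum_prod_type]
  simp_rw [Finset.mul_sum]
  rw [Finset.sum_comm, Finset.sum_comm (γ := Fin 2)]
  refine Finset.sum_congr rfl fun c _ => ?_
  rw [Finset.sum_eq_single (l, l), Finset.sum_eq_single (c 0).1]
  · simp only [Fin.consEquiv_apply, ← Fin.succ_last, Fin.cons_succ, Fin.cons_zero,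
      Fin.prod_univ_succ (n := n + 1), Fin.prod_univ_succ (n := n) (f := fun j => B j _ _),
      Fin.castSucc_zero, ← Fin.succ_castSucc, true_and, if_true]
    split_ifs
    · ring
    · simp
  · intro m _ hm
    rw [if_neg fun h => hm h.1.symm]
    simp
  · simp
  · rintro ⟨x, z⟩ _ hxz
    simp only [Fin.consEquiv_apply, Fin.cons_zero]
    split_ifs with h
    · have hz : z ≠ x := fun hz => hxz (by rw [hz, h.1])
      rw [Fin.prod_univ_succ]
      simp [hz]
    · rfl
  · simp

theorem det_chainMatrix (a : Fin 2 → ℂ) (n : ℕ) (B : Fin n → Matrix (Fin 2) (Fin 2) ℂ) :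
    (chainMatrix a n B).det = (a 0 * a 1) ^ (n + 1) * ∏ j, (B j).det := by
  induction n with
  | zero => simp [chainMatrix_zero]
  | succ n ih =>
    rw [chainMatrix_succ, Matrix.det_mul, Matrix.det_mul, ih, Matrix.det_diagonal,
      Fin.prod_univ_two, Fin.prod_univ_succ]
    ring

theorem negMulLog_le_two_mul_sqrt {x : ℝ} (hx : 0 ≤ x) :
    Real.negMulLog x ≤ 2 * (√x - x) := by
  rcases hx.eq_or_lt with rfl | hx
  · simp
  have hs : 0 < √x := Real.sqrt_pos.2 hx
  have hlog := Real.one_sub_inv_le_log_of_pos hs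
  have hsq : √x * √x = x := Real.mul_self_sqrt hx.le
  have hinv : x * (√x)⁻¹ = √x := by
    rw [← div_eq_mul_inv, Real.div_sqrt]
  rw [Real.log_sqrt hx.le] at hlog
  rw [Real.negMulLog]
  nlinarith [mul_le_mul_of_nonneg_left hlog hx.le]

/-- The binary entropy is at most twice the geometric mean of the two probabilities. -/
theorem negMulLog_add_negMulLog_le {p q : ℝ} (hp : 0 ≤ p) (hq : 0 ≤ q) (hpq : p + q = 1) :
    Real.negMulLog p + Real.negMulLog q ≤ 2 * √(p * q) := by
  have hp1 : √p ≤ 1 := Real.sqrt_le_one.2 (by linarith)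
  have hq1 : √q ≤ 1 := Real.sqrt_le_one.2 (by linarith)
  rw [Real.sqrt_mul hp]
  nlinarith [negMulLog_le_two_mul_sqrt hp, negMulLog_le_two_mul_sqrt hq,
    mul_nonneg (sub_nonneg.2 hp1) (sub_nonneg.2 hq1)]

open scoped ComplexOrder in
theorem vnEntropy_le_two_mul_sqrt_det {ρ : Matrix (Fin 2) (Fin 2) ℂ} (hρ : ρ.PosSemidef)
    (htr : ρ.trace = 1) : vnEntropy ρ ≤ 2 * √ρ.det.re := by
  have hH := hρ.isHermitian
  have hsum : hH.eigenvalues 0 + hH.eigenvalues 1 = 1 := by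
    have h := hH.trace_eq_sum_eigenvalues
    rw [htr, Fin.sum_univ_two] at h
    simpa using congrArg Complex.re h.symm
  have hdet : ρ.det.re = hH.eigenvalues 0 * hH.eigenvalues 1 := by
    rw [hH.det_eq_prod_eigenvalues, Fin.prod_univ_two]
    simp
  rw [vnEntropy, dif_pos hH, Fin.sum_univ_two, hdet]
  exact negMulLog_add_negMulLog_le (hρ.eigenvalues_nonneg 0) (hρ.eigenvalues_nonneg 1) hsum

open scoped ComplexOrder in
/-- Weighted entropy of the reduced state of the two-qubit vector with coefficient matrix `V`. -/
theorem mul_vnEntropy_reduced_le (V : Matrix (Fin 2) (Fin 2) ℂ) {p : ℝ} (hp : 0 < p)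
    (hV : p = ∑ lr : Fin 2 × Fin 2, ‖V lr.1 lr.2‖ ^ 2) :
    p * vnEntropy ((p : ℂ)⁻¹ • (V * V.conjTranspose)) ≤ 2 * ‖V.det‖ := by
  have hpos : ((p : ℂ)⁻¹ • (V * V.conjTranspose)).PosSemidef := by
    refine (Matrix.posSemidef_self_mul_conjTranspose V).smul ?_
    rw [← Complex.ofReal_inv]
    exact_mod_cast (inv_pos.2 hp).le
  have htr : ((p : ℂ)⁻¹ • (V * V.conjTranspose)).trace = 1 := by
    have h : (V * V.conjTranspose).trace = (p : ℂ) := by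
      rw [hV]
      simp [Matrix.trace, Matrix.mul_apply, Fintype.sum_prod_type, Complex.mul_conj']
    rw [Matrix.trace_smul, h, smul_eq_mul, inv_mul_cancel₀ (by exact_mod_cast hp.ne')]
  have hdet : ((p : ℂ)⁻¹ • (V * V.conjTranspose)).det.re = (p⁻¹ * ‖V.det‖) ^ 2 := by
    rw [Matrix.det_smul, Matrix.det_mul, Matrix.det_conjTranspose, Fintype.card_fin,
      Complex.star_def, Complex.mul_conj']
    norm_cast
    ring
  have h := vnEntropy_le_two_mul_sqrt_det hpos htr
  rw [hdet, Real.sqrt_sq (by positivity)] at h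
  calc _ ≤ p * (2 * (p⁻¹ * ‖V.det‖)) := mul_le_mul_of_nonneg_left h hp.le
    _ = _ := by field_simp

theorem norm_det_le_half {M : Matrix (Fin 2) (Fin 2) ℂ}
    (hM : ∑ x : Fin 2 × Fin 2, ‖M x.1 x.2‖ ^ 2 = 1) : ‖M.det‖ ≤ 1 / 2 := by
  simp only [Fintype.sum_prod_type, Fin.sum_univ_two] at hM
  rw [Matrix.det_fin_two]
  have h := norm_sub_le (M 0 0 * M 1 1) (M 0 1 * M 1 0)
  rw [norm_mul, norm_mul] at h
  nlinarith [sq_nonneg (‖M 0 0‖ - ‖M 1 1‖), sq_nonneg (‖M 0 1‖ - ‖M 1 0‖)]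

/-- Decay of post-measurement entanglement along a chain of qubits:
`n + 1` entangled pairs (registers `L_k R_k`, `k : Fin (n+1)`, configurations
`c : Fin (n+1) → Fin 2 × Fin 2` recording the values of `(L_k, R_k)`) in the
state `⊗_k (a0|00⟩ + a1|11⟩)`; the pairs `(R_j, L_{j+1})`, `j : Fin n`, are
measured in arbitrary orthonormal two-qubit bases `u j`.  The expected entropy
of the post-measurement state on `L₁` is at most `(2|a0·a1|)^{n+1}`. -/
theorem chain_avg_entropy_le
    (n : ℕ) (a : Fin 2 → ℂ) (ha : ‖a 0‖ ^ 2 + ‖a 1‖ ^ 2 = 1)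
    (u : Fin n → Fin 4 → Fin 2 × Fin 2 → ℂ)
    (hu : ∀ j, ∀ i i' : Fin 4,
      ∑ x : Fin 2 × Fin 2, (starRingEnd ℂ) (u j i x) * u j i' x = if i = i' then 1 else 0)
    -- unnormalized post-measurement amplitudes on the unmeasured registers (L₁, R_{last})
    (v : (Fin n → Fin 4) → Fin 2 × Fin 2 → ℂ)
    (hv : ∀ y : Fin n → Fin 4, ∀ lr : Fin 2 × Fin 2,
      v y lr = ∑ c : Fin (n + 1) → Fin 2 × Fin 2,
        if (c 0).1 = lr.1 ∧ (c (Fin.last n)).2 = lr.2 then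
          (∏ k : Fin (n + 1), if (c k).2 = (c k).1 then a (c k).1 else 0) *
            ∏ j : Fin n, (starRingEnd ℂ) (u j (y j) ((c j.castSucc).2, (c j.succ).1))
        else 0)
    -- outcome probabilities
    (P : (Fin n → Fin 4) → ℝ)
    (hP : ∀ y, P y = ∑ lr : Fin 2 × Fin 2, ‖v y lr‖ ^ 2)
    -- normalized post-measurement reduced density matrix on register L₁
    (ρ₁ : (Fin n → Fin 4) → Matrix (Fin 2) (Fin 2) ℂ)
    (hρ₁ : ∀ y, ∀ l l' : Fin 2, ρ₁ y l l' = ((P y : ℝ) : ℂ)⁻¹ *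
      ∑ r : Fin 2, v y (l, r) * (starRingEnd ℂ) (v y (l', r))) :
    ∑ y ∈ Finset.univ.filter (fun y : Fin n → Fin 4 => 0 < P y), P y * vnEntropy (ρ₁ y) ≤
      (2 * ‖a 0 * a 1‖) ^ (n + 1) := by
  let B : Fin n → Fin 4 → Matrix (Fin 2) (Fin 2) ℂ := fun j i =>
    Matrix.of fun x z => (starRingEnd ℂ) (u j i (x, z))
  have hB : ∀ j i, ‖(B j i).det‖ ≤ 1 / 2 := fun j i => by
    refine norm_det_le_half ?_
    have h := hu j i i
    simp only [Complex.conj_mul', if_true] at h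
    simp only [B, Matrix.of_apply, RCLike.norm_conj, Prod.mk.eta]
    exact_mod_cast h
  have hv' : ∀ y l r, v y (l, r) = chainMatrix a n (fun j => B j (y j)) l r := fun y l r => by
    rw [hv, chainMatrix]
    rfl
  have hterm : ∀ y, 0 < P y → P y * vnEntropy (ρ₁ y) ≤ 2 * ‖a 0 * a 1‖ ^ (n + 1) * (1 / 2) ^ n := by
    intro y hy
    let V := chainMatrix a n fun j => B j (y j)
    have hρ : ρ₁ y = ((P y : ℝ) : ℂ)⁻¹ • (V * V.conjTranspose) := by
      ext l l'
      simp [hρ₁, hv', V, Matrix.mul_apply]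
    have hVP : P y = ∑ lr : Fin 2 × Fin 2, ‖V lr.1 lr.2‖ ^ 2 := by
      simp only [hP, V, ← hv', Prod.mk.eta]
    have hprod : ∏ j, ‖(B j (y j)).det‖ ≤ (1 / 2) ^ n := by
      simpa using Finset.prod_le_prod (s := Finset.univ) (fun j _ => norm_nonneg (B j (y j)).det)
        fun j _ => hB j (y j)
    calc P y * vnEntropy (ρ₁ y) ≤ 2 * ‖V.det‖ := by
          rw [hρ]
          exact mul_vnEntropy_reduced_le V hy hVP
      _ = 2 * ‖a 0 * a 1‖ ^ (n + 1) * ∏ j, ‖(B j (y j)).det‖ := by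
          rw [det_chainMatrix, norm_mul, norm_pow, norm_prod, mul_assoc]
      _ ≤ _ := by gcongr
  calc _ ≤ ∑ y ∈ Finset.univ.filter (fun y : Fin n → Fin 4 => 0 < P y),
          2 * ‖a 0 * a 1‖ ^ (n + 1) * (1 / 2) ^ n :=
        Finset.sum_le_sum fun y hy => hterm y (Finset.mem_filter.1 hy).2
    _ ≤ ∑ y : Fin n → Fin 4, 2 * ‖a 0 * a 1‖ ^ (n + 1) * (1 / 2) ^ n :=
        Finset.sum_le_sum_of_subset_of_nonneg (Finset.filter_subset _ _)
          fun _ _ _ => by positivity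
    _ = (2 * ‖a 0 * a 1‖) ^ (n + 1) := by
        have h : (4 : ℝ) ^ n * (1 / 2) ^ n = 2 ^ n := by
          rw [← mul_pow]
          norm_num
        rw [Finset.sum_const, Finset.card_univ, Fintype.card_fun, Fintype.card_fin,
          Fintype.card_fin, nsmul_eq_mul, mul_pow, pow_succ (2 : ℝ), ← h]
        push_cast
        ring
end

section
/- Let X₁,…,X_M be nonempty finite sets (M ≥ 2) and let p be a probability distribution on X₁×⋯×X_M. Suppose that for every k ∈ {2,…,M−1}, the conditional mutual information (in nats) between coordinates (k+1,…,M) and coordinates (1,…,k−1) given coordinate k satisfies I(X_{k+1},…,X_M : X_1,…,X_{k−1} | X_k) ≤ ε. Define the Markov-chain approximation q : X₁×⋯×X_M → ℝ by q(x) := p_1(x_1) · ∏_{j=2}^{M} [ p_{j−1,j}(x_{j−1},x_j) / p_{j−1}(x_{j−1}) ], with q(x) := 0 whenever some p_{j−1}(x_{j−1}) = 0. Then ∑_x |p(x) − q(x)| ≤ (M−1)·√(2ε). -/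
open Classical

/-- Conditional mutual information (in nats) I(A:C|B) of the distribution
induced by `p : Γ → ℝ` under the projections `fA, fB, fC`. -/
noncomputable def condMI {Γ α β γ : Type*} [Fintype Γ] [Fintype α] [Fintype β] [Fintype γ]
    (p : Γ → ℝ) (fA : Γ → α) (fB : Γ → β) (fC : Γ → γ) : ℝ :=
  ∑ a : α, ∑ b : β, ∑ c : γ,
    let pabc := ∑ g, if fA g = a ∧ fB g = b ∧ fC g = c then p g else 0
    let pb := ∑ g, if fB g = b then p g else 0
    let pab := ∑ g, if fA g = a ∧ fB g = b then p g else 0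
    let pbc := ∑ g, if fB g = b ∧ fC g = c then p g else 0
    if 0 < pabc then pabc * Real.log (pabc * pb / (pab * pbc)) else 0

/-- The marginal of `p` along `f`. -/
noncomputable def marginal {Γ α : Type*} [Fintype Γ] (p : Γ → ℝ) (f : Γ → α) (a : α) : ℝ :=
  ∑ g, if f g = a then p g else 0

section Marginal

variable {Γ α β γ δ : Type*} [Fintype Γ] {p : Γ → ℝ}

theorem marginal_nonneg (hp : ∀ g, 0 ≤ p g) (f : Γ → α) (a : α) : 0 ≤ marginal p f a :=
  Finset.sum_nonneg fun i _ => by split_ifs <;> simp [hp i]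

theorem le_marginal (hp : ∀ g, 0 ≤ p g) (f : Γ → α) (g : Γ) : p g ≤ marginal p f (f g) := by
  have h := Finset.single_le_sum (f := fun g' => if f g' = f g then p g' else 0)
    (fun g' _ => by split_ifs <;> simp [hp g']) (Finset.mem_univ g)
  simpa [marginal] using h

theorem marginal_apply_congr {f : Γ → α} {f' : Γ → β} {a : α} {b : β}
    (h : ∀ g', f g' = a ↔ f' g' = b) : marginal p f a = marginal p f' b := by
  unfold marginal
  exact Finset.sum_congr rfl fun g' _ => by simp only [h g']

theorem sum_marginal_mul [Fintype α] (f : Γ → α) (F : α → ℝ) :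
    ∑ a, marginal p f a * F a = ∑ g, p g * F (f g) := by
  simp only [marginal, Finset.sum_mul]
  rw [Finset.sum_comm]
  refine Finset.sum_congr rfl fun g _ => ?_
  simp [ite_mul]

theorem sum_marginal [Fintype α] (f : Γ → α) : ∑ a, marginal p f a = ∑ g, p g := by
  simpa using sum_marginal_mul (p := p) f (fun _ => 1)

theorem sum_marginal_prodMk_left [Fintype α] (f : Γ → α) (h : Γ → β) (b : β) :
    ∑ a, marginal p (fun g => (f g, h g)) (a, b) = marginal p h b := by
  simp only [marginal, Prod.mk.injEq]
  rw [Finset.sum_comm]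
  refine Finset.sum_congr rfl fun g _ => ?_
  by_cases hb : h g = b <;> simp [hb]

theorem sum_marginal_prodMk_right [Fintype β] (f : Γ → α) (h : Γ → β) (a : α) :
    ∑ b, marginal p (fun g => (f g, h g)) (a, b) = marginal p f a := by
  simp only [marginal, Prod.mk.injEq]
  rw [Finset.sum_comm]
  refine Finset.sum_congr rfl fun g _ => ?_
  by_cases hb : f g = a <;> simp [hb]

/-- The conditional mutual information as the expectation of the log-density ratio. -/
theorem condMI_eq_sum_log [Fintype α] [Fintype β] [Fintype γ] (hp : ∀ g, 0 ≤ p g)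
    (fA : Γ → α) (fB : Γ → β) (fC : Γ → γ) :
    condMI p fA fB fC = ∑ g, p g *
      (Real.log (marginal p (fun g => (fA g, fB g, fC g)) (fA g, fB g, fC g))
        + Real.log (marginal p fB (fB g))
        - Real.log (marginal p (fun g => (fA g, fB g)) (fA g, fB g))
        - Real.log (marginal p (fun g => (fB g, fC g)) (fB g, fC g))) := by
  have key : condMI p fA fB fC = ∑ t : α × β × γ,
      marginal p (fun g => (fA g, fB g, fC g)) t *
        Real.log (marginal p (fun g => (fA g, fB g, fC g)) t * marginal p fB t.2.1 /
          (marginal p (fun g => (fA g, fB g)) (t.1, t.2.1) *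
            marginal p (fun g => (fB g, fC g)) t.2)) := by
    simp only [Fintype.sum_prod_type, condMI]
    refine Finset.sum_congr rfl fun a _ => Finset.sum_congr rfl fun b _ =>
      Finset.sum_congr rfl fun c _ => ?_
    have h0 := marginal_nonneg hp (fun g => (fA g, fB g, fC g)) (a, b, c)
    simp only [marginal, Prod.mk.injEq] at h0 ⊢
    split_ifs with h
    · rfl
    · rw [le_antisymm (not_lt.mp h) h0, zero_mul]
  rw [key, sum_marginal_mul (p := p) (fun g => (fA g, fB g, fC g))]
  refine Finset.sum_congr rfl fun g _ => ?_
  rcases (hp g).eq_or_lt with h | h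
  · simp [← h]
  have h1 := h.trans_le (le_marginal hp (fun g => (fA g, fB g, fC g)) g)
  have h2 := h.trans_le (le_marginal hp fB g)
  have h3 := h.trans_le (le_marginal hp (fun g => (fA g, fB g)) g)
  have h4 := h.trans_le (le_marginal hp (fun g => (fB g, fC g)) g)
  rw [Real.log_div (by positivity) (by positivity), Real.log_mul h1.ne' h2.ne',
    Real.log_mul h3.ne' h4.ne']
  ring

theorem condMI_nonneg [Fintype α] [Fintype β] [Fintype γ] (hp : ∀ g, 0 ≤ p g)
    (fA : Γ → α) (fB : Γ → β) (fC : Γ → γ) : 0 ≤ condMI p fA fB fC := by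
  set R : α × β × γ → ℝ := fun t =>
    marginal p (fun g => (fA g, fB g)) (t.1, t.2.1) * marginal p (fun g => (fB g, fC g)) t.2 /
      marginal p fB t.2.1 with hR
  have hR0 : ∀ t, 0 ≤ R t := fun t => div_nonneg
    (mul_nonneg (marginal_nonneg hp _ _) (marginal_nonneg hp _ _)) (marginal_nonneg hp _ _)
  have hRsum : ∑ t, R t ≤ ∑ g, p g := by
    have hb : ∑ t, R t = ∑ b, marginal p fB b * marginal p fB b / marginal p fB b := by
      simp only [Fintype.sum_prod_type, hR]
      rw [Finset.sum_comm]
      refine Finset.sum_congr rfl fun b _ => ?_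
      simp only [← Finset.sum_div, ← Finset.mul_sum, sum_marginal_prodMk_right]
      rw [← Finset.sum_mul, sum_marginal_prodMk_left]
    rw [hb, ← sum_marginal fB]
    exact (Finset.sum_congr rfl fun b _ => mul_self_div_self _).le
  have hsum : ∑ g, p g * (R (fA g, fB g, fC g) /
      marginal p (fun g => (fA g, fB g, fC g)) (fA g, fB g, fC g)) ≤ ∑ g, p g := by
    rw [← sum_marginal_mul (p := p) (fun g => (fA g, fB g, fC g))
      (fun t => R t / marginal p (fun g => (fA g, fB g, fC g)) t)]
    refine le_trans (Finset.sum_le_sum fun t _ => ?_) hRsum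
    rcases eq_or_ne (marginal p (fun g => (fA g, fB g, fC g)) t) 0 with h | h
    · simp [h, hR0 t]
    · rw [mul_div_cancel₀ _ h]
  rw [condMI_eq_sum_log hp]
  refine le_trans (sub_nonneg.mpr hsum) ?_
  rw [← Finset.sum_sub_distrib]
  refine Finset.sum_le_sum fun g _ => ?_
  rcases (hp g).eq_or_lt with h | h
  · simp [← h]
  have h1 := h.trans_le (le_marginal hp (fun g => (fA g, fB g, fC g)) g)
  have h2 := h.trans_le (le_marginal hp fB g)
  have h3 := h.trans_le (le_marginal hp (fun g => (fA g, fB g)) g)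
  have h4 := h.trans_le (le_marginal hp (fun g => (fB g, fC g)) g)
  simp only [hR]
  have hlog := Real.log_le_sub_one_of_pos (div_pos (div_pos (mul_pos h3 h4) h2) h1)
  rw [Real.log_div (by positivity) h1.ne', Real.log_div (by positivity) h2.ne',
    Real.log_mul h3.ne' h4.ne'] at hlog
  rw [← mul_one_sub]
  exact mul_le_mul_of_nonneg_left (by linarith) h.le

/-- Data processing: replacing `A` by a function `A'` of `A` decreases the conditional mutual
information. -/
theorem condMI_comp_le [Fintype α] [Fintype β] [Fintype γ] [Fintype δ] (hp : ∀ g, 0 ≤ p g)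
    (fA : Γ → α) (φ : α → δ) (fB : Γ → β) (fC : Γ → γ) :
    condMI p (fun g => φ (fA g)) fB fC ≤ condMI p fA fB fC := by
  have h := condMI_nonneg hp fA (fun g => (φ (fA g), fB g)) fC
  rw [condMI_eq_sum_log hp] at h
  rw [← sub_nonneg, condMI_eq_sum_log hp, condMI_eq_sum_log hp, ← Finset.sum_sub_distrib]
  refine h.trans_eq (Finset.sum_congr rfl fun g _ => ?_)
  have e1 : marginal p (fun g => (fA g, (φ (fA g), fB g), fC g)) (fA g, (φ (fA g), fB g), fC g)
      = marginal p (fun g => (fA g, fB g, fC g)) (fA g, fB g, fC g) :=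
    marginal_apply_congr fun g' => by
      simp only [Prod.mk.injEq]
      constructor
      · tauto
      · rintro ⟨h1, h2⟩
        simp [h1, h2]
  have e2 : marginal p (fun g => (fA g, (φ (fA g), fB g))) (fA g, (φ (fA g), fB g))
      = marginal p (fun g => (fA g, fB g)) (fA g, fB g) :=
    marginal_apply_congr fun g' => by
      simp only [Prod.mk.injEq]
      constructor
      · tauto
      · rintro ⟨h1, h2⟩
        simp [h1, h2]
  have e3 : marginal p (fun g => ((φ (fA g), fB g), fC g)) ((φ (fA g), fB g), fC g)
      = marginal p (fun g => (φ (fA g), fB g, fC g)) (φ (fA g), fB g, fC g) :=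
    marginal_apply_congr fun g' => by simp only [Prod.mk.injEq, and_assoc]
  rw [e1, e2, e3]
  ring

end Marginal

theorem div_le_log_of_pos {t : ℝ} (ht : 0 < t) :
    (t - 1) * (5 * t + 1) / (2 * t * (t + 2)) ≤ Real.log t := by
  set G : ℝ → ℝ := fun t => Real.log t - (t - 1) * (5 * t + 1) / (2 * t * (t + 2)) with hG
  have hd : ∀ x : ℝ, 0 < x → HasDerivAt G ((x - 1) ^ 3 / (x ^ 2 * (x + 2) ^ 2)) x := by
    intro x hx
    have h1 : HasDerivAt (fun t : ℝ => (t - 1) * (5 * t + 1))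
        (1 * (5 * x + 1) + (x - 1) * (5 * 1)) x :=
      ((hasDerivAt_id x).sub_const 1).mul (((hasDerivAt_id x).const_mul 5).add_const 1)
    have h2 : HasDerivAt (fun t : ℝ => 2 * t * (t + 2)) (2 * 1 * (x + 2) + 2 * x * 1) x :=
      ((hasDerivAt_id x).const_mul 2).mul ((hasDerivAt_id x).add_const 2)
    have h := (Real.hasDerivAt_log hx.ne').sub (h1.div h2 (by positivity))
    refine h.congr_deriv ?_
    field_simp
    ring
  have hG1 : G 1 = 0 := by simp [hG]
  have hcont : ContinuousOn G (Set.Ioi 0) := fun x hx => (hd x hx).continuousAt.continuousWithinAt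
  suffices h : G 1 ≤ G t by
    rw [hG1] at h
    exact sub_nonneg.mp h
  rcases le_total 1 t with h | h
  · refine monotoneOn_of_deriv_nonneg (convex_Ici 1)
      (hcont.mono fun x hx => Set.mem_Ioi.mpr (lt_of_lt_of_le one_pos hx)) ?_ ?_
      (Set.mem_Ici.mpr le_rfl) h h
    · intro x hx
      rw [interior_Ici] at hx
      exact (hd x (one_pos.trans hx)).differentiableAt.differentiableWithinAt
    · intro x hx
      rw [interior_Ici] at hx
      rw [(hd x (one_pos.trans hx)).deriv]
      have : 0 ≤ x - 1 := sub_nonneg.mpr (le_of_lt hx)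
      positivity
  · refine antitoneOn_of_deriv_nonpos (convex_Ioc 0 1)
      (hcont.mono fun x hx => hx.1) ?_ ?_ ⟨ht, h⟩ ⟨one_pos, le_rfl⟩ h
    · intro x hx
      rw [interior_Ioc] at hx
      exact (hd x hx.1).differentiableAt.differentiableWithinAt
    · intro x hx
      rw [interior_Ioc] at hx
      rw [(hd x hx.1).deriv]
      refine div_nonpos_of_nonpos_of_nonneg ?_ (by positivity)
      exact Odd.pow_nonpos (by decide) (by linarith [hx.2])

theorem three_mul_sub_sq_le {a b : ℝ} (ha : 0 < a) (hb : 0 < b) :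
    3 * (a - b) ^ 2 / (2 * a + 4 * b) ≤ a * (Real.log a - Real.log b) - a + b := by
  have h := div_le_log_of_pos (div_pos ha hb)
  rw [Real.log_div ha.ne' hb.ne'] at h
  have h' := mul_le_mul_of_nonneg_left h ha.le
  have e : a * ((a / b - 1) * (5 * (a / b) + 1) / (2 * (a / b) * (a / b + 2)))
      = 3 * (a - b) ^ 2 / (2 * a + 4 * b) + a - b := by
    field_simp
    ring
  linarith

/-- Pinsker's inequality for a distribution `p` and a subdistribution `q`. -/
theorem sum_abs_sub_sq_le {Γ : Type*} [Fintype Γ] {p q : Γ → ℝ} (hp : ∀ g, 0 ≤ p g)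
    (hq : ∀ g, 0 ≤ q g) (hp1 : ∑ g, p g = 1) (hq1 : ∑ g, q g ≤ 1)
    (hpq : ∀ g, 0 < p g → 0 < q g) :
    (∑ g, |p g - q g|) ^ 2 ≤ 2 * ∑ g, p g * (Real.log (p g) - Real.log (q g)) := by
  have hcs : (∑ g, |p g - q g|) ^ 2 ≤ (∑ g, (2 * p g + 4 * q g) / 3) *
      ∑ g, 3 * (p g - q g) ^ 2 / (2 * p g + 4 * q g) := by
    refine Finset.sum_sq_le_sum_mul_sum_of_sq_le_mul _ (fun g _ => ?_) (fun g _ => ?_)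
      (fun g _ => ?_)
    · have := hp g; have := hq g; positivity
    · have := hp g; have := hq g; positivity
    · rw [sq_abs]
      rcases (hq g).eq_or_lt with h | h
      · have : p g = 0 := le_antisymm (not_lt.mp fun h' => (hpq g h').ne h) (hp g)
        simp [← h, this]
      · have := hp g
        refine le_of_eq ?_
        field_simp
  have h1 : ∑ g, (2 * p g + 4 * q g) / 3 ≤ 2 := by
    rw [← Finset.sum_div, Finset.sum_add_distrib, ← Finset.mul_sum, ← Finset.mul_sum]
    linarith
  have h2 : ∑ g, 3 * (p g - q g) ^ 2 / (2 * p g + 4 * q g) ≤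
      ∑ g, p g * (Real.log (p g) - Real.log (q g)) := by
    have : ∑ g, 3 * (p g - q g) ^ 2 / (2 * p g + 4 * q g) ≤
        ∑ g, (p g * (Real.log (p g) - Real.log (q g)) - p g + q g) := by
      refine Finset.sum_le_sum fun g _ => ?_
      rcases (hp g).eq_or_lt with h | h
      · rcases (hq g).eq_or_lt with h' | h'
        · simp [← h, ← h']
        · rw [← h, div_le_iff₀ (by positivity)]
          nlinarith [sq_nonneg (q g)]
      · exact three_mul_sub_sq_le h (hpq g h)
    rw [Finset.sum_add_distrib, Finset.sum_sub_distrib] at this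
    linarith
  have h0 : 0 ≤ ∑ g, 3 * (p g - q g) ^ 2 / (2 * p g + 4 * q g) :=
    Finset.sum_nonneg fun g _ => by have := hp g; have := hq g; positivity
  exact hcs.trans (mul_le_mul h1 h2 h0 (by norm_num))

/-- The path weights of a substochastic chain sum to at most the initial mass. -/
theorem sum_mul_prod_kernel_le {n : ℕ} (X : Fin (n + 1) → Type*) [∀ j, Fintype (X j)]
    (w : X 0 → ℝ) (hw : ∀ a, 0 ≤ w a) (K : ∀ j : Fin n, X j.castSucc → X j.succ → ℝ)
    (hK : ∀ j a b, 0 ≤ K j a b) (hK1 : ∀ j a, ∑ b, K j a b ≤ 1) :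
    ∑ x : ∀ j, X j, w (x 0) * ∏ j : Fin n, K j (x j.castSucc) (x j.succ) ≤ ∑ a, w a := by
  induction n with
  | zero =>
    rw [← (Fin.consEquiv X).sum_comp, Fintype.sum_prod_type]
    simp [Fin.consEquiv]
  | succ n ih =>
    have h := ih (fun j => X j.succ) (fun b => ∑ a, w a * K 0 a b)
      (fun b => Finset.sum_nonneg fun a _ => mul_nonneg (hw a) (hK 0 a b))
      (fun j a b => K j.succ a b) (fun j a b => hK j.succ a b) (fun j a => hK1 j.succ a)
    have hle : ∑ b, ∑ a, w a * K 0 a b ≤ ∑ a, w a := by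
      rw [Finset.sum_comm]
      refine Finset.sum_le_sum fun a _ => ?_
      rw [← Finset.mul_sum]
      exact mul_le_of_le_one_right (hw a) (hK1 0 a)
    refine le_trans (le_of_eq ?_) (h.trans hle)
    rw [← (Fin.consEquiv X).sum_comp, Fintype.sum_prod_type, Finset.sum_comm]
    refine Finset.sum_congr rfl fun y _ => ?_
    rw [Finset.sum_mul]
    refine Finset.sum_congr rfl fun a _ => ?_
    rw [Fin.prod_univ_succ, ← mul_assoc]
    rfl


/-- The marginal of `p` on the coordinates `0, …, n`, evaluated at the restriction of `x`. -/
noncomputable def initialMarginal {N : ℕ} {X : Fin N → Type*} [∀ j, Fintype (X j)]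
    (p : (∀ j, X j) → ℝ) (n : ℕ) (x : ∀ j, X j) : ℝ :=
  marginal p (fun g => fun j : {j : Fin N // j.val ≤ n} => g j.1) (fun j => x j.1)

/-- The Markov-chain approximation of `p`. -/
noncomputable def markovApprox {n : ℕ} {X : Fin (n + 1) → Type*} [∀ j, Fintype (X j)]
    (p : (∀ j, X j) → ℝ) (x : ∀ j, X j) : ℝ :=
  marginal p (fun g => g 0) (x 0) * ∏ j : Fin n,
    (marginal p (fun g => (g j.castSucc, g j.succ)) (x j.castSucc, x j.succ) /
      marginal p (fun g => g j.castSucc) (x j.castSucc))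

section MarkovApprox

variable {n : ℕ} {X : Fin (n + 1) → Type*} [∀ j, Fintype (X j)] {p : (∀ j, X j) → ℝ}

theorem markovApprox_nonneg (hp : ∀ x, 0 ≤ p x) (x : ∀ j, X j) : 0 ≤ markovApprox p x :=
  mul_nonneg (marginal_nonneg hp _ _) (Finset.prod_nonneg fun _ _ =>
    div_nonneg (marginal_nonneg hp _ _) (marginal_nonneg hp _ _))

theorem markovApprox_pos (hp : ∀ x, 0 ≤ p x) {x : ∀ j, X j} (hx : 0 < p x) :
    0 < markovApprox p x :=
  mul_pos (hx.trans_le (le_marginal hp (fun g => g 0) x)) (Finset.prod_pos fun j _ =>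
    div_pos (hx.trans_le (le_marginal hp (fun g => (g j.castSucc, g j.succ)) x))
      (hx.trans_le (le_marginal hp (fun g => g j.castSucc) x)))

theorem sum_markovApprox_le (hp : ∀ x, 0 ≤ p x) : ∑ x, markovApprox p x ≤ ∑ x, p x := by
  have h := sum_mul_prod_kernel_le X (marginal p (fun g => g 0)) (marginal_nonneg hp _)
    (fun j a b => marginal p (fun g => (g j.castSucc, g j.succ)) (a, b) /
      marginal p (fun g => g j.castSucc) a)
    (fun j a b => div_nonneg (marginal_nonneg hp _ _) (marginal_nonneg hp _ _))
    (fun j a => by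
      rw [← Finset.sum_div, sum_marginal_prodMk_right]
      exact div_self_le_one _)
  rwa [sum_marginal] at h

theorem log_markovApprox (hp : ∀ x, 0 ≤ p x) {x : ∀ j, X j} (hx : 0 < p x) :
    Real.log (markovApprox p x) = Real.log (marginal p (fun g => g 0) (x 0)) +
      ∑ j : Fin n,
        (Real.log (marginal p (fun g => (g j.castSucc, g j.succ)) (x j.castSucc, x j.succ)) -
          Real.log (marginal p (fun g => g j.castSucc) (x j.castSucc))) := by
  have h0 := hx.trans_le (le_marginal hp (fun g => g 0) x)
  have h1 := fun j : Fin n =>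
    hx.trans_le (le_marginal hp (fun g => (g j.castSucc, g j.succ)) x)
  have h2 := fun j : Fin n => hx.trans_le (le_marginal hp (fun g => g j.castSucc) x)
  rw [markovApprox, Real.log_mul h0.ne'
    (Finset.prod_pos fun j _ => div_pos (h1 j) (h2 j)).ne',
    Real.log_prod fun j _ => (div_pos (h1 j) (h2 j)).ne']
  congr 1
  exact Finset.sum_congr rfl fun j _ => Real.log_div (h1 j).ne' (h2 j).ne'

theorem initialMarginal_zero (x : ∀ j, X j) :
    initialMarginal p 0 x = marginal p (fun g => g 0) (x 0) :=
  marginal_apply_congr fun g => by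
    simp only [funext_iff, Subtype.forall]
    refine ⟨fun h => h 0 le_rfl, fun h j hj => ?_⟩
    obtain rfl : j = 0 := Fin.ext (Nat.le_zero.mp hj)
    exact h

theorem initialMarginal_last (x : ∀ j, X j) : initialMarginal p n x = p x := by
  have h : initialMarginal p n x = marginal p id x := marginal_apply_congr fun g => by
    simp only [funext_iff, Subtype.forall]
    exact ⟨fun h j => h j (Nat.lt_succ_iff.mp j.isLt), fun h j _ => h j⟩
  rw [h, marginal]
  refine (Finset.sum_eq_single x (fun g _ hg => if_neg hg) (by simp)).trans (if_pos rfl)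

theorem log_eq_initialMarginal (x : ∀ j, X j) :
    Real.log (p x) = Real.log (marginal p (fun g => g 0) (x 0)) +
      ∑ j : Fin n, (Real.log (initialMarginal p (j.val + 1) x) -
        Real.log (initialMarginal p j.val x)) := by
  rw [Fin.sum_univ_eq_sum_range (fun j => Real.log (initialMarginal p (j + 1) x) -
    Real.log (initialMarginal p j x)),
    Finset.sum_range_sub (fun j => Real.log (initialMarginal p j x)), initialMarginal_zero,
    initialMarginal_last]
  ring

end MarkovApprox

section Chain

variable {m : ℕ} {X : Fin (m + 2) → Type*} [∀ j, Fintype (X j)] {p : (∀ j, X j) → ℝ}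

theorem initialMarginal_one (x : ∀ j, X j) : initialMarginal p 1 x =
    marginal p (fun g => (g (Fin.castSucc (0 : Fin (m + 1))), g (Fin.succ (0 : Fin (m + 1)))))
      (x (Fin.castSucc (0 : Fin (m + 1))), x (Fin.succ (0 : Fin (m + 1)))) :=
  marginal_apply_congr fun g => by
    simp only [funext_iff, Subtype.forall, Prod.mk.injEq]
    refine ⟨fun h => ⟨h _ (by simp), h _ (by simp)⟩, fun h j hj => ?_⟩
    rcases Nat.le_one_iff_eq_zero_or_eq_one.mp hj with hj | hj
    · obtain rfl : j = Fin.castSucc 0 := Fin.ext hj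
      exact h.1
    · obtain rfl : j = Fin.succ 0 := Fin.ext hj
      exact h.2

/-- The next-step conditional mutual information as an expectation. -/
theorem condMI_next_eq (hp : ∀ x, 0 ≤ p x) (k : Fin m) :
    condMI p (fun g => g k.succ.succ) (fun g => g k.succ.castSucc)
      (fun g => fun j : {j : Fin (m + 2) // j.val ≤ k.val} => g j.1) =
    ∑ x, p x * (Real.log (initialMarginal p (k.val + 2) x)
      - Real.log (initialMarginal p (k.val + 1) x)
      - (Real.log (marginal p (fun g => (g k.succ.castSucc, g k.succ.succ))
          (x k.succ.castSucc, x k.succ.succ))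
        - Real.log (marginal p (fun g => g k.succ.castSucc) (x k.succ.castSucc)))) := by
  rw [condMI_eq_sum_log hp]
  refine Finset.sum_congr rfl fun x _ => ?_
  have e1 : initialMarginal p (k.val + 1) x = marginal p
      (fun g => (g k.succ.castSucc, fun j : {j : Fin (m + 2) // j.val ≤ k.val} => g j.1))
      (x k.succ.castSucc, fun j => x j.1) := marginal_apply_congr fun g => by
    simp only [funext_iff, Subtype.forall, Prod.mk.injEq]
    refine ⟨fun h => ⟨h _ (by simp), fun j hj => h j (by omega)⟩, fun h j hj => ?_⟩
    rcases Nat.le_succ_iff.mp hj with hj | hj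
    · exact h.2 j hj
    · obtain rfl : j = k.succ.castSucc := Fin.ext hj
      exact h.1
  have e2 : initialMarginal p (k.val + 2) x = marginal p
      (fun g => (g k.succ.succ, g k.succ.castSucc,
        fun j : {j : Fin (m + 2) // j.val ≤ k.val} => g j.1))
      (x k.succ.succ, x k.succ.castSucc, fun j => x j.1) := marginal_apply_congr fun g => by
    simp only [funext_iff, Subtype.forall, Prod.mk.injEq]
    refine ⟨fun h => ⟨h _ (by simp), h _ (by simp), fun j hj => h j (by omega)⟩,
      fun h j hj => ?_⟩
    rcases Nat.le_succ_iff.mp hj with hj | hj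
    · rcases Nat.le_succ_iff.mp hj with hj | hj
      · exact h.2.2 j hj
      · obtain rfl : j = k.succ.castSucc := Fin.ext hj
        exact h.2.1
    · obtain rfl : j = k.succ.succ := Fin.ext hj
      exact h.1
  have e3 : marginal p (fun g => (g k.succ.succ, g k.succ.castSucc))
      (x k.succ.succ, x k.succ.castSucc) =
      marginal p (fun g => (g k.succ.castSucc, g k.succ.succ))
        (x k.succ.castSucc, x k.succ.succ) :=
    marginal_apply_congr fun g => by simp only [Prod.mk.injEq, and_comm]
  rw [e1, e2, e3]
  ring

/-- The chain rule for the relative entropy of `p` with respect to its Markov approximation. -/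
theorem sum_mul_log_sub_log_markovApprox (hp : ∀ x, 0 ≤ p x) :
    ∑ x, p x * (Real.log (p x) - Real.log (markovApprox p x)) =
      ∑ k : Fin m, condMI p (fun g => g k.succ.succ) (fun g => g k.succ.castSucc)
        (fun g => fun j : {j : Fin (m + 2) // j.val ≤ k.val} => g j.1) := by
  simp only [condMI_next_eq hp]
  rw [Finset.sum_comm]
  refine Finset.sum_congr rfl fun x _ => ?_
  rw [← Finset.mul_sum]
  rcases (hp x).eq_or_lt with h | h
  · simp [← h]
  congr 1
  rw [log_eq_initialMarginal, log_markovApprox hp h, add_sub_add_left_eq_sub,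
    ← Finset.sum_sub_distrib, Fin.sum_univ_succ]
  have h0 : Real.log (initialMarginal p ((0 : Fin (m + 1)).val + 1) x) -
      Real.log (initialMarginal p (0 : Fin (m + 1)).val x) -
      (Real.log (marginal p
        (fun g => (g (Fin.castSucc (0 : Fin (m + 1))), g (Fin.succ (0 : Fin (m + 1)))))
        (x (Fin.castSucc (0 : Fin (m + 1))), x (Fin.succ (0 : Fin (m + 1))))) -
      Real.log (marginal p (fun g => g (Fin.castSucc (0 : Fin (m + 1))))
        (x (Fin.castSucc (0 : Fin (m + 1)))))) = 0 := by
    rw [← initialMarginal_one]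
    simp only [Fin.val_zero, zero_add]
    rw [initialMarginal_zero]
    simp only [Fin.castSucc_zero]
    ring
  rw [h0, zero_add]
  rfl

end Chain

/-- Markov-chain approximation from small conditional mutual information
(M = m + 2 coordinates, 0-indexed; the 1-indexed coordinates k ∈ {2,…,M−1} of
the statement correspond to the 0-indexed coordinate k.val + 1 for k : Fin m).
If I(X_{k+1},…,X_M : X_1,…,X_{k−1} | X_k) ≤ ε for all such k, then the
Markov-chain approximation q is (M−1)·√(2ε)-close to p in ℓ¹ distance. -/
theorem cmi_implies_markov_chain_approx
    (m : ℕ) (X : Fin (m + 2) → Type) [∀ j, Fintype (X j)] [∀ j, Nonempty (X j)]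
    (p : (∀ j, X j) → ℝ) (hp0 : ∀ x, 0 ≤ p x) (hp1 : ∑ x, p x = 1)
    (ε : ℝ)
    (hCMI : ∀ k : Fin m,
      condMI p
        (fun g => fun j : {j : Fin (m + 2) // k.val + 2 ≤ j.val} => g j.1)
        (fun g => g ⟨k.val + 1, by have := k.isLt; omega⟩)
        (fun g => fun j : {j : Fin (m + 2) // j.val ≤ k.val} => g j.1) ≤ ε) :
    ∑ x : ∀ j, X j,
      |p x -
        (∑ g : ∀ j, X j, if g 0 = x 0 then p g else 0) *
          ∏ j : Fin (m + 1),
            ((∑ g : ∀ i, X i, if g j.castSucc = x j.castSucc ∧ g j.succ = x j.succ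
                then p g else 0) /
             (∑ g : ∀ i, X i, if g j.castSucc = x j.castSucc then p g else 0))| ≤
      ((m + 2 : ℝ) - 1) * Real.sqrt (2 * ε) := by
  have hstep : ∀ k : Fin m, condMI p (fun g => g k.succ.succ) (fun g => g k.succ.castSucc)
      (fun g => fun j : {j : Fin (m + 2) // j.val ≤ k.val} => g j.1) ≤ ε := by
    intro k
    have h := condMI_comp_le (p := p) hp0
      (fun g => fun j : {j : Fin (m + 2) // k.val + 2 ≤ j.val} => g j.1)
      (fun a => a ⟨k.succ.succ, by simp⟩) (fun g => g k.succ.castSucc)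
      (fun g => fun j : {j : Fin (m + 2) // j.val ≤ k.val} => g j.1)
    exact h.trans (hCMI k)
  have hpinsker := sum_abs_sub_sq_le hp0 (markovApprox_nonneg hp0) hp1
    ((sum_markovApprox_le hp0).trans_eq hp1) (fun _ h => markovApprox_pos hp0 h)
  rw [sum_mul_log_sub_log_markovApprox hp0] at hpinsker
  have hsum := Finset.sum_le_sum fun (k : Fin m) (_ : k ∈ Finset.univ) => hstep k
  rw [Finset.sum_const, Finset.card_univ, Fintype.card_fin, nsmul_eq_mul] at hsum
  have hmain : ∑ x, |p x - markovApprox p x| ≤ ((m + 2 : ℝ) - 1) * Real.sqrt (2 * ε) := by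
    have hm : ((m + 2 : ℝ) - 1) = m + 1 := by ring
    rw [hm]
    refine abs_le_of_sq_le_sq' ?_ (by positivity) |>.2
    rcases Nat.eq_zero_or_pos m with h0 | hpos
    · have : (m : ℝ) = 0 := by exact_mod_cast h0
      rw [this] at hsum
      nlinarith [sq_nonneg (((m : ℝ) + 1) * Real.sqrt (2 * ε))]
    · have hε : 0 ≤ ε := (condMI_nonneg hp0 _ _ _).trans (hstep ⟨0, hpos⟩)
      rw [mul_pow, Real.sq_sqrt (by positivity)]
      nlinarith [mul_nonneg (sq_nonneg (m : ℝ)) hε, mul_nonneg (Nat.cast_nonneg (α := ℝ) m) hε]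
  simpa only [markovApprox, marginal, Prod.mk.injEq] using hmain
end
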